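/- arXiv:1208.4013 — 3 statements merged into one kernel-verified Lean document; each statement's English description precedes it below -/
import Mathlib

section
/- Let {v₁,...,vₙ} be an orthonormal basis of ℝⁿ, L an n×n real matrix with ‖Lvᵢ‖ = 1 for every i, 1 ≤ m ≤ n, and A = Σ_{i=1}^m (Lvᵢ)(Lvᵢ)ᵀ. Let δ > 0, b' = b − δ, b' > δ, and assume A has exactly m nonzero eigenvalues (with multiplicity), each greater than b. If Tr[Lᵀ(A − bI)⁻¹L] ≤ −n − 2‖L‖²/δ, then there exists an index j with m < j ≤ n such that the vector ω = Lvⱼ satisfies both: (1) ωᵀ(A − b'I)⁻¹ω < −1, and (2) Tr[Lᵀ(A + ωωᵀ − b'I)⁻¹L] ≤ Tr[Lᵀ(A − bI)⁻¹L] ≤ −n − 2‖L‖²/δ. -/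
open Matrix

section

variable {ι : Type*} [Fintype ι] [DecidableEq ι]

theorem conj_diagonal_mul_conj_diagonal {U : Matrix ι ι ℝ} (hU : U * Uᵀ = 1) (d e : ι → ℝ) :
    U * diagonal d * Uᵀ * (U * diagonal e * Uᵀ) = U * diagonal (fun i => d i * e i) * Uᵀ := by
  have hU' : Uᵀ * U = 1 := mul_eq_one_comm.mp hU
  calc U * diagonal d * Uᵀ * (U * diagonal e * Uᵀ)
      = U * (diagonal d * (Uᵀ * U) * diagonal e) * Uᵀ := by simp only [Matrix.mul_assoc]
    _ = U * diagonal (fun i => d i * e i) * Uᵀ := by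
        rw [hU', Matrix.mul_one, diagonal_mul_diagonal]

theorem conj_diagonal_mul_conj_diagonal_inv {U : Matrix ι ι ℝ} (hU : U * Uᵀ = 1) {d : ι → ℝ}
    (hd : ∀ i, d i ≠ 0) :
    U * diagonal d * Uᵀ * (U * diagonal (fun i => (d i)⁻¹) * Uᵀ) = 1 := by
  rw [conj_diagonal_mul_conj_diagonal hU]
  simp [hd, hU]

theorem trace_conj_diagonal {U : Matrix ι ι ℝ} (hU : U * Uᵀ = 1) (d : ι → ℝ) :
    (U * diagonal d * Uᵀ).trace = ∑ i, d i := by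
  rw [trace_mul_comm, ← Matrix.mul_assoc, mul_eq_one_comm.mp hU, Matrix.one_mul, trace_diagonal]

theorem transpose_conj_diagonal (U : Matrix ι ι ℝ) (d : ι → ℝ) :
    (U * diagonal d * Uᵀ)ᵀ = U * diagonal d * Uᵀ := by
  simp [Matrix.mul_assoc]

theorem conj_diagonal_sub_smul_one {U : Matrix ι ι ℝ} (hU : U * Uᵀ = 1) (d : ι → ℝ) (b : ℝ) :
    U * diagonal d * Uᵀ - b • 1 = U * diagonal (fun i => d i - b) * Uᵀ := by
  have h : diagonal (fun i => d i - b) = diagonal d - b • (1 : Matrix ι ι ℝ) := by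
    rw [smul_one_eq_diagonal, diagonal_sub]
  rw [h, Matrix.mul_sub, Matrix.sub_mul, Matrix.mul_smul, Matrix.mul_one, Matrix.smul_mul, hU]

theorem dotProduct_conj_diagonal_mulVec (U : Matrix ι ι ℝ) (d x : ι → ℝ) :
    x ⬝ᵥ ((U * diagonal d * Uᵀ) *ᵥ x) = ∑ i, d i * (Uᵀ *ᵥ x) i ^ 2 := by
  rw [← mulVec_mulVec, ← mulVec_mulVec, dotProduct_mulVec, ← mulVec_transpose]
  simp only [dotProduct, mulVec_diagonal]
  exact Finset.sum_congr rfl fun i _ => by ring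

theorem trace_transpose_mul_mul_eq_sum {V : Matrix ι ι ℝ} (hV : V * Vᵀ = 1)
    (L X : Matrix ι ι ℝ) :
    (Lᵀ * X * L).trace = ∑ j, (L *ᵥ V j) ⬝ᵥ (X *ᵥ (L *ᵥ V j)) := by
  have hV' : Vᵀ * V = 1 := mul_eq_one_comm.mp hV
  have h : (Lᵀ * X * L).trace = (V * (Lᵀ * X * L) * Vᵀ).trace := by
    rw [trace_mul_comm (V * _), ← Matrix.mul_assoc, hV', Matrix.one_mul]
  rw [h, trace]
  refine Finset.sum_congr rfl fun j _ => ?_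
  rw [dotProduct_mulVec, dotProduct_mulVec, ← mulVec_transpose X, ← mulVec_transpose L,
    mulVec_mulVec, mulVec_mulVec, diag_apply, Matrix.mul_apply]
  rw [dotProduct]
  refine Finset.sum_congr rfl fun i _ => ?_
  rw [transpose_apply, mul_apply_eq_vecMul, ← mulVec_transpose]
  simp [Matrix.mul_assoc]

theorem inv_add_vecMulVec_self {B : Matrix ι ι ℝ} (hB : IsUnit B.det) (x : ι → ℝ)
    (h : 1 + x ⬝ᵥ (B⁻¹ *ᵥ x) ≠ 0) :
    (B + vecMulVec x x)⁻¹ =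
      B⁻¹ - (1 + x ⬝ᵥ (B⁻¹ *ᵥ x))⁻¹ • vecMulVec (B⁻¹ *ᵥ x) (x ᵥ* B⁻¹) := by
  refine inv_eq_right_inv ?_
  set c := x ⬝ᵥ (B⁻¹ *ᵥ x) with hc
  rw [Matrix.add_mul, Matrix.mul_sub, Matrix.mul_sub, mul_nonsing_inv _ hB, Matrix.mul_smul,
    Matrix.mul_smul, mul_vecMulVec, mulVec_mulVec, mul_nonsing_inv _ hB, one_mulVec,
    vecMulVec_mul, vecMulVec_mul_vecMulVec, ← hc]
  ext i j
  simp only [Matrix.add_apply, Matrix.sub_apply, Matrix.smul_apply, vecMulVec_apply,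
    smul_eq_mul, Pi.smul_apply]
  field_simp
  ring

theorem dotProduct_transpose_mulVec_le (L : Matrix ι ι ℝ) (x : ι → ℝ) :
    (Lᵀ *ᵥ x) ⬝ᵥ (Lᵀ *ᵥ x) ≤ ‖toEuclideanCLM (𝕜 := ℝ) L‖ ^ 2 * (x ⬝ᵥ x) := by
  have hself : ∀ y : ι → ℝ, y ⬝ᵥ y = ‖WithLp.toLp 2 y‖ ^ 2 := fun y => by
    rw [EuclideanSpace.real_norm_sq_eq]
    exact Finset.sum_congr rfl fun i _ => (sq _).symm
  have hL : ‖toEuclideanCLM (𝕜 := ℝ) Lᵀ‖ = ‖toEuclideanCLM (𝕜 := ℝ) L‖ := by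
    rw [← norm_star (toEuclideanCLM (𝕜 := ℝ) L), ← map_star, star_eq_conjTranspose,
      conjTranspose_eq_transpose_of_trivial]
  rw [hself, hself, ← mul_pow, ← hL, ← toEuclideanCLM_toLp]
  exact pow_le_pow_left₀ (norm_nonneg _) (ContinuousLinearMap.le_opNorm _ _) 2

theorem Matrix.IsHermitian.exists_eq_conj_diagonal_eigenvalues {A : Matrix ι ι ℝ}
    (hA : A.IsHermitian) :
    ∃ U : Matrix ι ι ℝ, U * Uᵀ = 1 ∧ A = U * diagonal hA.eigenvalues * Uᵀ :=
  ⟨hA.eigenvectorUnitary, Unitary.coe_mul_star_self hA.eigenvectorUnitary, hA.spectral_theorem⟩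

theorem trace_transpose_mul_inv_add_vecMulVec_mul {B M : Matrix ι ι ℝ} (hBM : B * M = 1)
    (hM : Mᵀ = M) (L : Matrix ι ι ℝ) (x : ι → ℝ) (h : 1 + x ⬝ᵥ (M *ᵥ x) ≠ 0) :
    (Lᵀ * (B + vecMulVec x x)⁻¹ * L).trace = (Lᵀ * M * L).trace -
      (1 + x ⬝ᵥ (M *ᵥ x))⁻¹ * ((Lᵀ *ᵥ (M *ᵥ x)) ⬝ᵥ (Lᵀ *ᵥ (M *ᵥ x))) := by
  have hinv : B⁻¹ = M := inv_eq_right_inv hBM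
  rw [← hinv] at h
  rw [inv_add_vecMulVec_self (isUnit_det_of_right_inverse hBM) x h, hinv, ← mulVec_transpose M, hM,
    Matrix.mul_sub, Matrix.sub_mul, trace_sub, Matrix.mul_smul, Matrix.smul_mul, trace_smul,
    mul_vecMulVec, vecMulVec_mul, trace_vecMulVec, ← mulVec_transpose L, smul_eq_mul]

/-- Shifting the barrier from `b` to `b - δ` gains at least half of `δ * (t - (b - δ))⁻¹ ^ 2`. -/
theorem inv_sq_le_inv_sub_inv {b δ t : ℝ} (hδ : 0 < δ) (hb : δ < b - δ) (ht : t = 0 ∨ b < t) :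
    (t - (b - δ))⁻¹ ^ 2 ≤ 2 / δ * ((t - b)⁻¹ - (t - (b - δ))⁻¹) := by
  have key : ∀ y : ℝ, y ≠ 0 → y + δ ≠ 0 → 0 < (y + δ) * y → 0 ≤ 2 * (y + δ) * y - y ^ 2 →
      (y + δ)⁻¹ ^ 2 ≤ 2 / δ * (y⁻¹ - (y + δ)⁻¹) := by
    intro y hy hyδ hpos hnn
    have e : 2 / δ * (y⁻¹ - (y + δ)⁻¹) - (y + δ)⁻¹ ^ 2 =
        (2 * (y + δ) * y - y ^ 2) / ((y + δ) * y) ^ 2 := by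
      field_simp
      ring
    have := div_nonneg hnn (sq_nonneg ((y + δ) * y))
    linarith
  have e : t - (b - δ) = (t - b) + δ := by ring
  rw [e]
  rcases ht with rfl | ht
  · exact key _ (by linarith) (by linarith) (by nlinarith) (by nlinarith)
  · exact key _ (by linarith) (by linarith) (by nlinarith) (by nlinarith)

end

/-- The main Spielman–Srivastava one-step theorem (adjusted constants). -/
theorem spielman_srivastava_step
    (n m : ℕ) (hm1 : 1 ≤ m) (hmn : m ≤ n)
    (v : Fin n → Fin n → ℝ)
    (hortho : ∀ i j : Fin n, v i ⬝ᵥ v j = if i = j then (1 : ℝ) else 0)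
    (L : Matrix (Fin n) (Fin n) ℝ)
    (hnorm : ∀ i : Fin n, (L *ᵥ v i) ⬝ᵥ (L *ᵥ v i) = 1)
    (A : Matrix (Fin n) (Fin n) ℝ)
    (hAdef : A = ∑ i ∈ Finset.univ.filter (fun i : Fin n => (i : ℕ) < m),
        vecMulVec (L *ᵥ v i) (L *ᵥ v i))
    (b δ b' : ℝ) (hδ : 0 < δ) (hb' : b' = b - δ) (hδb' : δ < b')
    (hA : A.IsHermitian)
    (hcard : (Finset.univ.filter (fun i : Fin n => hA.eigenvalues i ≠ 0)).card = m)
    (heig : ∀ i : Fin n, hA.eigenvalues i ≠ 0 → b < hA.eigenvalues i)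
    (htr : (Lᵀ * (A - b • 1)⁻¹ * L).trace ≤
      -(n : ℝ) - 2 * ‖Matrix.toEuclideanCLM (𝕜 := ℝ) L‖ ^ 2 / δ) :
    ∃ j : Fin n, m ≤ (j : ℕ) ∧
      (L *ᵥ v j) ⬝ᵥ ((A - b' • 1)⁻¹ *ᵥ (L *ᵥ v j)) < -1 ∧
      (Lᵀ * (A + vecMulVec (L *ᵥ v j) (L *ᵥ v j) - b' • 1)⁻¹ * L).trace ≤
        (Lᵀ * (A - b • 1)⁻¹ * L).trace ∧
      (Lᵀ * (A - b • 1)⁻¹ * L).trace ≤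
        -(n : ℝ) - 2 * ‖Matrix.toEuclideanCLM (𝕜 := ℝ) L‖ ^ 2 / δ := by
  obtain ⟨U, hU, hAU⟩ := hA.exists_eq_conj_diagonal_eigenvalues
  set lam := hA.eigenvalues
  have hlam : ∀ i, lam i = 0 ∨ b < lam i := fun i => or_iff_not_imp_left.mpr (heig i)
  subst hb'
  have hne : ∀ i, lam i - b ≠ 0 := fun i => by
    rcases hlam i with h | h
    · rw [h]; linarith
    · linarith
  have hne' : ∀ i, lam i - (b - δ) ≠ 0 := fun i => by
    rcases hlam i with h | h
    · rw [h]; linarith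
    · linarith
  have hM := conj_diagonal_mul_conj_diagonal_inv hU hne
  have hM' := conj_diagonal_mul_conj_diagonal_inv hU hne'
  rw [← conj_diagonal_sub_smul_one hU, ← hAU] at hM hM'
  rw [inv_eq_right_inv hM] at htr ⊢
  rw [inv_eq_right_inv hM']
  have htransM' := transpose_conj_diagonal U fun i => (lam i - (b - δ))⁻¹
  have hV : Matrix.of v * (Matrix.of v)ᵀ = 1 := by
    ext i j
    rw [Matrix.one_apply, ← hortho i j]
    rfl
  have htrace : ∀ d : Fin n → ℝ, (Lᵀ * (U * diagonal d * Uᵀ) * L).trace =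
      ∑ j, ∑ i, d i * (Uᵀ *ᵥ (L *ᵥ v j)) i ^ 2 := fun d => by
    rw [trace_transpose_mul_mul_eq_sum hV]
    exact Finset.sum_congr rfl fun j _ => dotProduct_conj_diagonal_mulVec U d _
  set M' := U * diagonal (fun i => (lam i - (b - δ))⁻¹) * Uᵀ with hM'def
  set T := (Lᵀ * (U * diagonal (fun i => (lam i - b)⁻¹) * Uᵀ) * L).trace with hT
  set T' := (Lᵀ * M' * L).trace with hT'
  set N := ‖Matrix.toEuclideanCLM (𝕜 := ℝ) L‖
  set q : Fin n → ℝ := fun j =>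
    (Lᵀ *ᵥ (M' *ᵥ (L *ᵥ v j))) ⬝ᵥ (Lᵀ *ᵥ (M' *ᵥ (L *ᵥ v j)))
  set p : Fin n → ℝ := fun j => (L *ᵥ v j) ⬝ᵥ (M' *ᵥ (L *ᵥ v j))
  have hT'p : T' = ∑ j, p j := trace_transpose_mul_mul_eq_sum hV L M'
  have hq0 : ∀ j, 0 ≤ q j := fun j => Finset.sum_nonneg fun i _ => mul_self_nonneg _
  set S : Fin n → ℝ := fun j => ∑ i, (lam i - (b - δ))⁻¹ ^ 2 * (Uᵀ *ᵥ (L *ᵥ v j)) i ^ 2 with hS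
  have hqS : ∀ j, q j ≤ N ^ 2 * S j := fun j => by
    refine (dotProduct_transpose_mulVec_le L _).trans_eq ?_
    congr 1
    rw [dotProduct_mulVec, ← mulVec_transpose, htransM', mulVec_mulVec, dotProduct_comm, hM'def,
      conj_diagonal_mul_conj_diagonal hU, dotProduct_conj_diagonal_mulVec]
    simp only [hS, sq]
  have hSpos : ∀ j, 0 < S j := fun j => by
    have hunit : ∑ i, (Uᵀ *ᵥ (L *ᵥ v j)) i ^ 2 = 1 := by
      have h := dotProduct_conj_diagonal_mulVec U (fun _ => 1) (L *ᵥ v j)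
      simpa [hU, hnorm j] using h.symm
    obtain ⟨i, -, hi⟩ := Finset.exists_ne_zero_of_sum_ne_zero (hunit.trans_ne one_ne_zero)
    refine Finset.sum_pos' (fun i _ => by positivity) ⟨i, Finset.mem_univ i, ?_⟩
    have h1 := inv_ne_zero (hne' i)
    positivity
  have hSle : ∑ j, S j ≤ 2 / δ * (T - T') := by
    rw [hT, hT', htrace, htrace, ← Finset.sum_sub_distrib, Finset.mul_sum]
    refine Finset.sum_le_sum fun j _ => ?_
    rw [← Finset.sum_sub_distrib, Finset.mul_sum]
    refine Finset.sum_le_sum fun i _ => ?_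
    rw [← sub_mul, ← mul_assoc]
    exact mul_le_mul_of_nonneg_right (inv_sq_le_inv_sub_inv hδ hδb' (hlam i)) (sq_nonneg _)
  have hΔ : 0 < T - T' := by
    have h : 0 < ∑ j, S j :=
      Finset.sum_pos (fun j _ => hSpos j) ⟨⟨0, hm1.trans hmn⟩, Finset.mem_univ _⟩
    exact (mul_pos_iff_of_pos_left (by positivity)).mp (h.trans_le hSle)
  have hpA : 0 ≤ ∑ j ∈ Finset.univ.filter (fun j : Fin n => (j : ℕ) < m), p j := by
    have h : ∑ j ∈ Finset.univ.filter (fun j : Fin n => (j : ℕ) < m), p j = (M' * A).trace := by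
      rw [hAdef, Finset.mul_sum, trace_sum]
      refine Finset.sum_congr rfl fun j _ => ?_
      rw [mul_vecMulVec, trace_vecMulVec, dotProduct_comm]
    rw [h, hAU, hM'def, conj_diagonal_mul_conj_diagonal hU, trace_conj_diagonal hU]
    refine Finset.sum_nonneg fun i _ => ?_
    rcases hlam i with h | h
    · rw [h, mul_zero]
    · exact mul_nonneg (inv_nonneg.mpr (by linarith)) (by linarith)
  have hsplit : ∑ j ∈ Finset.univ.filter (fun j : Fin n => (j : ℕ) < m), p j +
      ∑ j ∈ Finset.univ.filter (fun j : Fin n => ¬ (j : ℕ) < m), p j = T' := by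
    rw [Finset.sum_filter_add_sum_filter_not, hT'p]
  obtain ⟨j, hj, hlt⟩ : ∃ j : Fin n, ¬ (j : ℕ) < m ∧ q j < (T - T') * (-1 - p j) := by
    by_contra! hcon
    have hsum : ∑ j ∈ Finset.univ.filter (fun j : Fin n => ¬ (j : ℕ) < m),
        (T - T') * (-1 - p j) ≤ ∑ j, N ^ 2 * S j :=
      calc _ ≤ ∑ j ∈ Finset.univ.filter (fun j : Fin n => ¬ (j : ℕ) < m), q j :=
            Finset.sum_le_sum fun j hj => hcon j (not_lt.mp (Finset.mem_filter.mp hj).2)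
        _ ≤ ∑ j, q j := Finset.sum_le_univ_sum_of_nonneg hq0
        _ ≤ _ := Finset.sum_le_sum fun j _ => hqS j
    have hcount : ((Finset.univ.filter fun j : Fin n => ¬ (j : ℕ) < m).card : ℝ) ≤ n := by
      exact_mod_cast (Finset.card_le_univ _).trans_eq (Fintype.card_fin n)
    rw [← Finset.mul_sum, ← Finset.mul_sum, Finset.sum_sub_distrib, Finset.sum_const,
      nsmul_eq_mul] at hsum
    have hlow : (T - T') * (2 * N ^ 2 / δ + (T - T')) ≤ N ^ 2 * (2 / δ * (T - T')) :=
      (mul_le_mul_of_nonneg_left (by linarith) hΔ.le).trans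
        (hsum.trans (mul_le_mul_of_nonneg_left hSle (sq_nonneg N)))
    have e : N ^ 2 * (2 / δ * (T - T')) = (T - T') * (2 * N ^ 2 / δ) := by ring
    rw [e] at hlow
    linarith [le_of_mul_le_mul_left hlow hΔ]
  have hpj : 0 < -1 - p j := (mul_pos_iff_of_pos_left hΔ).mp ((hq0 j).trans_lt hlt)
  refine ⟨j, not_lt.mp hj, by linarith, ?_, htr⟩
  rw [add_sub_right_comm, trace_transpose_mul_inv_add_vecMulVec_mul hM' htransM' L _
    (show 1 + p j ≠ 0 by linarith)]
  change T' - (1 + p j)⁻¹ * q j ≤ T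
  have e : (1 + p j)⁻¹ * q j = -(q j / (-1 - p j)) := by
    rw [show 1 + p j = -(-1 - p j) by ring, inv_neg, div_eq_mul_inv]
    ring
  rw [e]
  linarith [(div_lt_iff₀ hpj).mpr hlt]
end

section
/- Let A be an n×n real symmetric positive semidefinite matrix, let b, δ, b' be reals with δ > 0, b' = b − δ, and b' ≥ δ, and assume every nonzero eigenvalue of A is greater than b. Then (A − bI)⁻¹ − (A − b'I)⁻¹ ≥ (δ/2)·(A − b'I)⁻² in the Loewner order, i.e. the matrix (A − bI)⁻¹ − (A − b'I)⁻¹ − (δ/2)(A − b'I)⁻² is positive semidefinite. -/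
open Matrix

/-- The resolvent of a Hermitian matrix, diagonalized in its eigenvector basis. -/
lemma Matrix.IsHermitian.inv_sub_smul_one {n : Type*} [Fintype n] [DecidableEq n]
    {A : Matrix n n ℝ} (hA : A.IsHermitian) {c : ℝ} (hc : ∀ i, hA.eigenvalues i ≠ c) :
    (A - c • 1)⁻¹ = Unitary.conjStarAlgAut ℝ _ hA.eigenvectorUnitary
      (diagonal fun i => (hA.eigenvalues i - c)⁻¹) := by
  have key : A - c • 1 = Unitary.conjStarAlgAut ℝ _ hA.eigenvectorUnitary
      (diagonal fun i => hA.eigenvalues i - c) := by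
    have hd : (diagonal fun i => hA.eigenvalues i - c) =
        diagonal (RCLike.ofReal ∘ hA.eigenvalues) - c • (1 : Matrix n n ℝ) := by
      ext i j
      by_cases h : i = j <;> simp [h]
    rw [hd, map_sub, map_smul, map_one, ← hA.spectral_theorem]
  refine Matrix.inv_eq_right_inv ?_
  rw [key, ← map_mul, diagonal_mul_diagonal]
  simp [mul_inv_cancel₀ (sub_ne_zero.2 (hc _))]

/-- The scalar inequality satisfied at each point `t` of the spectrum. -/
lemma inv_sub_inv_sub_half_mul_sq_nonneg {b δ t : ℝ} (hδ : 0 < δ) (hb : δ ≤ b - δ)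
    (ht : t = 0 ∨ b < t) :
    0 ≤ (t - b)⁻¹ - (t - (b - δ))⁻¹ -
      δ / 2 * ((t - (b - δ))⁻¹ * (t - (b - δ))⁻¹) := by
  have h₁ : t - b ≠ 0 := by rcases ht with rfl | h <;> intro h' <;> linarith
  have h₂ : t - (b - δ) ≠ 0 := by rcases ht with rfl | h <;> intro h' <;> linarith
  have h : (t - b)⁻¹ - (t - (b - δ))⁻¹ - δ / 2 * ((t - (b - δ))⁻¹ * (t - (b - δ))⁻¹) =
      δ / 2 * ((t - b + 2 * δ) / (t - b)) / (t - (b - δ)) ^ 2 := by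
    field_simp
    ring
  rw [h]
  have hq : 0 ≤ (t - b + 2 * δ) / (t - b) := by
    rcases ht with rfl | h
    · exact div_nonneg_of_nonpos (by linarith) (by linarith)
    · exact div_nonneg (by linarith) (by linarith)
  positivity

/-- Step I — `(A − bI)⁻¹ − (A − b'I)⁻¹ ≥ (δ/2)(A − b'I)⁻²` in the Loewner order. -/
theorem step_one_loewner
    (n : ℕ) (A : Matrix (Fin n) (Fin n) ℝ) (hA : A.PosSemidef)
    (b δ b' : ℝ) (hδ : 0 < δ) (hb' : b' = b - δ) (hδb' : δ ≤ b')
    (heig : ∀ i : Fin n, hA.isHermitian.eigenvalues i ≠ 0 → b < hA.isHermitian.eigenvalues i) :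
    ((A - b • 1)⁻¹ - (A - b' • 1)⁻¹ -
      (δ / 2) • ((A - b' • 1)⁻¹ * (A - b' • 1)⁻¹)).PosSemidef := by
  subst hb'
  have hspec (i) : hA.isHermitian.eigenvalues i = 0 ∨ b < hA.isHermitian.eigenvalues i :=
    or_iff_not_imp_left.2 (heig i)
  rw [hA.isHermitian.inv_sub_smul_one (c := b)
      fun i h => by rcases hspec i with h' | h' <;> linarith,
    hA.isHermitian.inv_sub_smul_one (c := b - δ)
      fun i h => by rcases hspec i with h' | h' <;> linarith,
    ← map_mul, ← map_smul, ← map_sub, ← map_sub, diagonal_mul_diagonal, ← diagonal_smul,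
    diagonal_sub, diagonal_sub, Unitary.conjStarAlgAut_apply]
  exact (PosSemidef.diagonal fun i =>
    inv_sub_inv_sub_half_mul_sq_nonneg hδ hδb' (hspec i)).mul_mul_conjTranspose_same _
end

section
/- (Bourgain–Tzafriri Restricted Invertibility, with constants (1−2ε)(1−ε).) Let 0 < ε < 1/2, let {v₁,...,vₙ} be an orthonormal basis of ℝⁿ, and let L be an n×n real matrix with ‖Lvᵢ‖ = 1 for every i. Then there exists a subset σ ⊆ {1,...,n} with |σ| ≥ ε²n/‖L‖² such that for all real scalars (aᵢ)_{i∈σ}: ‖Σ_{i∈σ} aᵢ Lvᵢ‖² ≥ (1−2ε)(1−ε) · Σ_{i∈σ} aᵢ². -/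
open Matrix

namespace RestrictedInvertibility

variable {ι κ E : Type*} [NormedAddCommGroup E] [InnerProductSpace ℝ E]

/-- The frame operator `x ↦ ∑ i ∈ σ, ⟪w i, x⟫ w i` of the subfamily of `w` indexed by `σ`. -/
noncomputable def frameOp (w : ι → E) (σ : Finset ι) : E →ₗ[ℝ] E :=
  ∑ i ∈ σ, (innerₛₗ ℝ (w i)).smulRight (w i)

/-- The subfamily of `w` indexed by `σ` is a Riesz sequence with lower bound strictly above `b`. -/
def StrictRiesz (w : ι → E) (σ : Finset ι) (b : ℝ) : Prop :=
  ∀ a : ι → ℝ, (∃ i ∈ σ, a i ≠ 0) → b * ∑ i ∈ σ, a i ^ 2 < ‖∑ i ∈ σ, a i • w i‖ ^ 2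

/-- `N` is a right inverse of `A - b`. -/
def IsResolvent (A : E →ₗ[ℝ] E) (b : ℝ) (N : E →ₗ[ℝ] E) : Prop :=
  ∀ x, A (N x) - b • N x = x

theorem frameOp_apply (w : ι → E) (σ : Finset ι) (x : E) :
    frameOp w σ x = ∑ i ∈ σ, inner ℝ (w i) x • w i := by
  simp [frameOp, LinearMap.sum_apply]

theorem inner_frameOp (w : ι → E) (σ : Finset ι) (x y : E) :
    inner ℝ (frameOp w σ x) y = ∑ i ∈ σ, inner ℝ (w i) x * inner ℝ (w i) y := by
  simp [frameOp_apply, sum_inner, real_inner_smul_left]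

theorem frameOp_isSymmetric (w : ι → E) (σ : Finset ι) : (frameOp w σ).IsSymmetric := by
  intro x y
  rw [inner_frameOp, real_inner_comm, inner_frameOp]
  exact Finset.sum_congr rfl fun i _ => mul_comm _ _

theorem StrictRiesz.mono {w : ι → E} {σ : Finset ι} {b b' : ℝ} (h : StrictRiesz w σ b)
    (hb : b' ≤ b) : StrictRiesz w σ b' := fun a ha =>
  lt_of_le_of_lt (mul_le_mul_of_nonneg_right hb (Finset.sum_nonneg fun _ _ => sq_nonneg _)) (h a ha)

/-- The nonzero eigenvalues of the frame operator exceed the lower Riesz bound. -/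
theorem StrictRiesz.eigenvalue {w : ι → E} {σ : Finset ι} {b : ℝ} (h : StrictRiesz w σ b)
    {x : E} (hx : x ≠ 0) {l : ℝ} (hl : frameOp w σ x = l • x) : l = 0 ∨ b < l := by
  have hsum : ∑ i ∈ σ, inner ℝ (w i) x ^ 2 = l * ‖x‖ ^ 2 := by
    have := inner_frameOp w σ x x
    rw [hl, real_inner_smul_left, real_inner_self_eq_norm_sq] at this
    rw [this]
    exact Finset.sum_congr rfl fun i _ => pow_two _
  have hx2 : 0 < ‖x‖ ^ 2 := by positivity
  by_cases hz : ∃ i ∈ σ, inner ℝ (w i) x ≠ 0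
  · right
    have h1 := h (fun i => inner ℝ (w i) x) hz
    rw [← frameOp_apply, hl, hsum, norm_smul, mul_pow, Real.norm_eq_abs, sq_abs] at h1
    have hl0 : 0 < l := by
      obtain ⟨i, hi, hne⟩ := hz
      have : 0 < ∑ i ∈ σ, inner ℝ (w i) x ^ 2 :=
        Finset.sum_pos' (fun i _ => sq_nonneg _) ⟨i, hi, by positivity⟩
      rw [hsum] at this
      exact pos_of_mul_pos_left this hx2.le
    have h2 : 0 < (l - b) * (l * ‖x‖ ^ 2) := by nlinarith
    exact sub_pos.mp (pos_of_mul_pos_left h2 (by positivity))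
  · left
    push Not at hz
    rw [Finset.sum_eq_zero fun i hi => by rw [hz i hi]; ring] at hsum
    exact (mul_eq_zero.mp hsum.symm).resolve_right hx2.ne'

section Spectral

variable [Fintype κ] {A N : E →ₗ[ℝ] E} {b : ℝ} (e : OrthonormalBasis κ ℝ E) {l : κ → ℝ}

theorem IsResolvent.inner_eigenvector (hN : IsResolvent A b N) (hA : A.IsSymmetric)
    (he : ∀ i, A (e i) = l i • e i) (hl : ∀ i, l i ≠ b) (i : κ) (x : E) :
    inner ℝ (e i) (N x) = (l i - b)⁻¹ * inner ℝ (e i) x := by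
  have h : inner ℝ (e i) x = (l i - b) * inner ℝ (e i) (N x) := by
    conv_lhs => rw [← hN x]
    rw [inner_sub_right, ← hA, he, real_inner_smul_left, real_inner_smul_right]
    ring
  rw [h, inv_mul_cancel_left₀ (sub_ne_zero.mpr (hl i))]

theorem IsResolvent.inner_apply (hN : IsResolvent A b N) (hA : A.IsSymmetric)
    (he : ∀ i, A (e i) = l i • e i) (hl : ∀ i, l i ≠ b) (x y : E) :
    inner ℝ x (N y) = ∑ i, (l i - b)⁻¹ * (inner ℝ (e i) x * inner ℝ (e i) y) := by
  rw [← e.sum_inner_mul_inner]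
  refine Finset.sum_congr rfl fun i _ => ?_
  rw [hN.inner_eigenvector e hA he hl, real_inner_comm]
  ring

theorem IsResolvent.norm_apply_sq (hN : IsResolvent A b N) (hA : A.IsSymmetric)
    (he : ∀ i, A (e i) = l i • e i) (hl : ∀ i, l i ≠ b) (x : E) :
    ‖N x‖ ^ 2 = ∑ i, (l i - b)⁻¹ ^ 2 * inner ℝ (e i) x ^ 2 := by
  rw [← e.sum_sq_inner_right]
  refine Finset.sum_congr rfl fun i _ => ?_
  rw [hN.inner_eigenvector e hA he hl, mul_pow]

theorem IsResolvent.isSymmetric (hN : IsResolvent A b N) (hA : A.IsSymmetric)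
    (he : ∀ i, A (e i) = l i • e i) (hl : ∀ i, l i ≠ b) : N.IsSymmetric := by
  intro x y
  rw [real_inner_comm, hN.inner_apply e hA he hl, hN.inner_apply e hA he hl]
  exact Finset.sum_congr rfl fun i _ => by ring

end Spectral

theorem exists_isResolvent [FiniteDimensional ℝ E] {A : E →ₗ[ℝ] E} {b : ℝ}
    (h : ∀ x, A x = b • x → x = 0) : ∃ N, IsResolvent A b N := by
  have hinj : Function.Injective (A - b • (LinearMap.id : E →ₗ[ℝ] E)) := by
    rw [← LinearMap.ker_eq_bot, LinearMap.ker_eq_bot']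
    intro x hx
    exact h x (by simpa [sub_eq_zero] using hx)
  let B := LinearEquiv.ofInjectiveEndo _ hinj
  exact ⟨B.symm.toLinearMap, B.apply_symm_apply⟩

/-- Sherman–Morrison formula for the resolvent of a rank-one perturbation. -/
theorem IsResolvent.rankOne_update {A N : E →ₗ[ℝ] E} {b : ℝ} (hN : IsResolvent A b N)
    (hs : N.IsSymmetric) {u : E} (hu : 1 + inner ℝ u (N u) ≠ 0) :
    IsResolvent (A + (innerₛₗ ℝ u).smulRight u) b
      (N - (1 + inner ℝ u (N u))⁻¹ • (innerₛₗ ℝ (N u)).smulRight (N u)) := by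
  intro x
  have h1 : A (N x) = x + b • N x := by rw [← sub_eq_iff_eq_add]; exact hN x
  have h2 : A (N u) = u + b • N u := by rw [← sub_eq_iff_eq_add]; exact hN u
  have h3 : inner ℝ (N u) x = inner ℝ u (N x) := hs u x
  simp only [LinearMap.add_apply, LinearMap.sub_apply, LinearMap.smul_apply,
    LinearMap.smulRight_apply, innerₛₗ_apply_apply, map_sub, map_smul, h1, h2, h3]
  match_scalars
  · ring
  · ring
  · field_simp
    ring
  · field_simp
    ring

/-- Adjoining a vector `u = w j` with `⟪u, (A - b)⁻¹ u⟫ < -1` preserves the lower Riesz bound. -/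
theorem StrictRiesz.insert [DecidableEq ι] {w : ι → E} {σ : Finset ι} {b : ℝ} (hb : 0 < b)
    (h : StrictRiesz w σ b) {j : ι} (hj : j ∉ σ) {z : E}
    (hz : frameOp w σ z - b • z = w j) (hlt : inner ℝ (w j) z < -1) :
    StrictRiesz w (insert j σ) b := by
  intro a ha
  rw [Finset.sum_insert hj, Finset.sum_insert hj]
  set c := a j with hc
  set d : ι → ℝ := fun i => a i + c * inner ℝ (w i) z with hd
  have hAz : frameOp w σ z = w j + b • z := by rw [← sub_eq_iff_eq_add]; exact hz
  have hvec : c • w j + ∑ i ∈ σ, a i • w i = (∑ i ∈ σ, d i • w i) - (c * b) • z := by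
    have : ∑ i ∈ σ, d i • w i = (∑ i ∈ σ, a i • w i) + c • frameOp w σ z := by
      rw [frameOp_apply, Finset.smul_sum, ← Finset.sum_add_distrib]
      exact Finset.sum_congr rfl fun i _ => by simp only [hd]; module
    rw [this, hAz]
    module
  have hzz : ∑ i ∈ σ, inner ℝ (w i) z ^ 2 = inner ℝ (w j) z + b * ‖z‖ ^ 2 := by
    have := inner_frameOp w σ z z
    rw [hAz, inner_add_left, real_inner_smul_left, real_inner_self_eq_norm_sq] at this
    rw [this]
    exact Finset.sum_congr rfl fun i _ => pow_two _
  have hdz : inner ℝ (∑ i ∈ σ, d i • w i) z = ∑ i ∈ σ, d i * inner ℝ (w i) z := by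
    simp [sum_inner, real_inner_smul_left]
  have hsq : ∑ i ∈ σ, a i ^ 2 = ∑ i ∈ σ, d i ^ 2 - 2 * c * ∑ i ∈ σ, d i * inner ℝ (w i) z
      + c ^ 2 * ∑ i ∈ σ, inner ℝ (w i) z ^ 2 := by
    rw [Finset.mul_sum, Finset.mul_sum, ← Finset.sum_sub_distrib, ← Finset.sum_add_distrib]
    exact Finset.sum_congr rfl fun i _ => by simp only [hd]; ring
  have hgap : ‖c • w j + ∑ i ∈ σ, a i • w i‖ ^ 2 - b * (c ^ 2 + ∑ i ∈ σ, a i ^ 2)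
      = (‖∑ i ∈ σ, d i • w i‖ ^ 2 - b * ∑ i ∈ σ, d i ^ 2)
        + c ^ 2 * (b * (-1 - inner ℝ (w j) z)) := by
    rw [hvec, norm_sub_sq_real, real_inner_smul_right, hdz, hsq, hzz, norm_smul, mul_pow,
      Real.norm_eq_abs, sq_abs]
    ring
  have hpos : 0 < b * (-1 - inner ℝ (w j) z) := mul_pos hb (by linarith)
  by_cases hex : ∃ i ∈ σ, d i ≠ 0
  · have h1 := h d hex
    have h2 : 0 ≤ c ^ 2 * (b * (-1 - inner ℝ (w j) z)) := by positivity
    linarith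
  · push Not at hex
    have hc0 : c ≠ 0 := by
      intro h0
      obtain ⟨i, hi, hai⟩ := ha
      rcases Finset.mem_insert.mp hi with rfl | hi
      · exact hai h0
      · apply hai
        simpa [hd, h0] using hex i hi
    have h1 : ∑ i ∈ σ, d i • w i = 0 := Finset.sum_eq_zero fun i hi => by rw [hex i hi, zero_smul]
    have h2 : ∑ i ∈ σ, d i ^ 2 = 0 := Finset.sum_eq_zero fun i hi => by rw [hex i hi]; ring
    have h3 : 0 < c ^ 2 * (b * (-1 - inner ℝ (w j) z)) := by positivity
    rw [h1, h2, norm_zero] at hgap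
    linarith

/-- The scalar inequality behind a shift of the barrier. -/
theorem barrier_shift [Fintype κ] {c l : κ → ℝ} {b b' n Λ : ℝ} (hc : ∀ i, 0 ≤ c i)
    (hb' : 0 < b') (hbb : b' < b) (hn : 0 ≤ n) (hΛ : 0 < Λ) (hl : ∀ i, l i = 0 ∨ b < l i)
    (hpot : ∑ i, (l i - b)⁻¹ * c i ≤ -n - Λ / (b - b')) :
    0 < ∑ i, (l i - b)⁻¹ * c i - ∑ i, (l i - b')⁻¹ * c i ∧
    Λ * ∑ i, (l i - b')⁻¹ ^ 2 * c i ≤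
      (∑ i, (l i - b)⁻¹ * c i - ∑ i, (l i - b')⁻¹ * c i) *
        (-n - ∑ i, (l i - b')⁻¹ * c i) := by
  classical
  set X := ∑ i, (l i - b)⁻¹ * c i with hX
  set Y := ∑ i, (l i - b')⁻¹ * c i with hY
  set Z := ∑ i, if l i = 0 then c i else 0 with hZ
  have hb : 0 < b := hb'.trans hbb
  set δ := b - b' with hδ
  have hδ0 : 0 < δ := sub_pos.mpr hbb
  have hXZ : -(b⁻¹ * Z) ≤ X := by
    rw [hX, hZ, Finset.mul_sum, ← Finset.sum_neg_distrib]
    refine Finset.sum_le_sum fun i _ => ?_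
    rcases hl i with h0 | h0
    · simp [h0, inv_neg]
    · have h1 : 0 < l i - b := sub_pos.mpr h0
      have h2 : l i ≠ 0 := (hb.trans h0).ne'
      have := hc i
      simp only [h2, if_false, mul_zero, neg_zero]
      positivity
  have hΔ : δ * (b⁻¹ * b'⁻¹ * Z) ≤ X - Y := by
    rw [hX, hY, hZ, Finset.mul_sum, Finset.mul_sum, ← Finset.sum_sub_distrib]
    refine Finset.sum_le_sum fun i _ => ?_
    rcases hl i with h0 | h0
    · simp only [h0, if_true, zero_sub, inv_neg, hδ]
      apply le_of_eq
      field_simp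
      ring
    · have h1 : 0 < l i - b := sub_pos.mpr h0
      have h2 : l i ≠ 0 := (hb.trans h0).ne'
      have h3 : (l i - b')⁻¹ ≤ (l i - b)⁻¹ := inv_anti₀ h1 (by linarith)
      simp only [h2, if_false, mul_zero]
      nlinarith [hc i]
  have hS : ∑ i, (l i - b')⁻¹ ^ 2 * c i ≤ (X - Y) / δ + δ * (b⁻¹ * b'⁻¹ ^ 2 * Z) := by
    rw [hX, hY, hZ, Finset.mul_sum, Finset.mul_sum, ← Finset.sum_sub_distrib, Finset.sum_div,
      ← Finset.sum_add_distrib]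
    refine Finset.sum_le_sum fun i _ => ?_
    rcases hl i with h0 | h0
    · simp only [h0, if_true, zero_sub, inv_neg]
      apply le_of_eq
      have : b = δ + b' := by simp [hδ]
      have h4 : δ + b' ≠ 0 := by positivity
      rw [this]
      field_simp
      ring
    · have h1 : 0 < l i - b := sub_pos.mpr h0
      have h2 : l i ≠ 0 := (hb.trans h0).ne'
      have h1' : 0 < l i - b' := by linarith
      have h3 : (l i - b')⁻¹ ≤ (l i - b)⁻¹ := inv_anti₀ h1 (by linarith)
      have h4 : (l i - b)⁻¹ - (l i - b')⁻¹ = δ * ((l i - b)⁻¹ * (l i - b')⁻¹) := by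
        rw [hδ]
        field_simp
        ring
      simp only [h2, if_false, mul_zero, add_zero]
      rw [← sub_mul, h4, mul_assoc, mul_div_cancel_left₀ _ hδ0.ne', pow_two]
      have := inv_pos.mpr h1'
      exact mul_le_mul_of_nonneg_right (mul_le_mul_of_nonneg_right h3 this.le) (hc i)
  have hZ1 : Λ / δ ≤ b⁻¹ * Z := by linarith
  have hq : 0 < Λ / δ := by positivity
  have hZpos : 0 < b⁻¹ * Z := hq.trans_le hZ1
  set t := b⁻¹ * Z with ht
  have hb'i : 0 < b'⁻¹ := inv_pos.mpr hb'
  have hΔ' : δ * b'⁻¹ * t ≤ X - Y := by rw [ht]; linarith [hΔ]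
  have hDpos : 0 < δ * b'⁻¹ * t := by positivity
  have hDXY : 0 < X - Y := hDpos.trans_le hΔ'
  refine ⟨hDXY, ?_⟩
  have hS' : ∑ i, (l i - b')⁻¹ ^ 2 * c i ≤ (X - Y) / δ + δ * (b'⁻¹ ^ 2 * t) := by
    rw [ht]; linarith [hS]
  have hΛt : Λ ≤ δ * t := by rw [mul_comm]; exact (div_le_iff₀ hδ0).mp hZ1
  calc Λ * ∑ i, (l i - b')⁻¹ ^ 2 * c i
      ≤ Λ * ((X - Y) / δ + δ * (b'⁻¹ ^ 2 * t)) := mul_le_mul_of_nonneg_left hS' hΛ.le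
    _ = (X - Y) * (Λ / δ) + Λ * (δ * (b'⁻¹ ^ 2 * t)) := by ring
    _ ≤ (X - Y) * (Λ / δ) + δ * t * (δ * (b'⁻¹ ^ 2 * t)) := by gcongr
    _ = (X - Y) * (Λ / δ) + (δ * b'⁻¹ * t) ^ 2 := by ring
    _ ≤ (X - Y) * (Λ / δ) + (X - Y) ^ 2 := by gcongr
    _ = (X - Y) * (Λ / δ + (X - Y)) := by ring
    _ ≤ (X - Y) * (-n - Y) := mul_le_mul_of_nonneg_left (by linarith) hDXY.le

/-- One step of the barrier argument: the barrier moves down from `b` to `b'`, one vector is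
adjoined, and the potential `∑ i, ⟪w i, (A - b)⁻¹ (w i)⟫` does not increase. -/
theorem exists_insert [Fintype ι] [DecidableEq ι] [FiniteDimensional ℝ E] {w : ι → E}
    {Λ : ℝ} (hΛ : 0 < Λ) (hbessel : ∀ x, ∑ i, inner ℝ (w i) x ^ 2 ≤ Λ * ‖x‖ ^ 2)
    {σ : Finset ι} {b b' : ℝ} (hb' : 0 < b') (hbb : b' < b) (hR : StrictRiesz w σ b)
    {N : E →ₗ[ℝ] E} (hN : IsResolvent (frameOp w σ) b N)
    (hpot : ∑ i, inner ℝ (w i) (N (w i)) ≤ -(Fintype.card ι : ℝ) - Λ / (b - b')) :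
    ∃ j ∉ σ, StrictRiesz w (insert j σ) b' ∧ ∃ N' : E →ₗ[ℝ] E,
      IsResolvent (frameOp w (insert j σ)) b' N' ∧
        ∑ i, inner ℝ (w i) (N' (w i)) ≤ ∑ i, inner ℝ (w i) (N (w i)) := by
  have hb : 0 < b := hb'.trans hbb
  have hA := frameOp_isSymmetric w σ
  set e := hA.eigenvectorBasis rfl
  set l := hA.eigenvalues rfl
  have he : ∀ i, frameOp w σ (e i) = l i • e i := hA.apply_eigenvectorBasis rfl
  have hl : ∀ i, l i = 0 ∨ b < l i := fun i => hR.eigenvalue (e.orthonormal.ne_zero i) (he i)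
  have hlb : ∀ i, l i ≠ b := fun i => by grind
  have hlb' : ∀ i, l i ≠ b' := fun i => by grind
  obtain ⟨M, hM⟩ : ∃ M, IsResolvent (frameOp w σ) b' M := exists_isResolvent fun x hx => by
    by_contra hne
    rcases hR.eigenvalue hne hx with h | h <;> linarith
  have hMs : M.IsSymmetric := hM.isSymmetric e hA he hlb'
  set c : Fin (Module.finrank ℝ E) → ℝ := fun i => ∑ j, inner ℝ (e i) (w j) ^ 2 with hc_def
  have hc : ∀ i, 0 ≤ c i := fun i => Finset.sum_nonneg fun j _ => sq_nonneg _
  have hX : ∑ j, inner ℝ (w j) (N (w j)) = ∑ i, (l i - b)⁻¹ * c i := by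
    simp_rw [hN.inner_apply e hA he hlb, hc_def, Finset.mul_sum, ← pow_two]
    exact Finset.sum_comm
  have hY : ∑ j, inner ℝ (w j) (M (w j)) = ∑ i, (l i - b')⁻¹ * c i := by
    simp_rw [hM.inner_apply e hA he hlb', hc_def, Finset.mul_sum, ← pow_two]
    exact Finset.sum_comm
  have hS : ∑ j, ‖M (w j)‖ ^ 2 = ∑ i, (l i - b')⁻¹ ^ 2 * c i := by
    simp_rw [hM.norm_apply_sq e hA he hlb', hc_def, Finset.mul_sum]
    exact Finset.sum_comm
  obtain ⟨hΔ, hkey⟩ := barrier_shift hc hb' hbb (Nat.cast_nonneg (Fintype.card ι)) hΛ hl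
    (hX ▸ hpot)
  rw [← hX, ← hY] at hΔ
  rw [← hX, ← hY, ← hS] at hkey
  set X := ∑ j, inner ℝ (w j) (N (w j)) with hXdef
  set Y := ∑ j, inner ℝ (w j) (M (w j)) with hYdef
  set Q : ι → ℝ := fun j => ∑ i, inner ℝ (w i) (M (w j)) ^ 2
  have hQ0 : ∀ j, 0 ≤ Q j := fun j => Finset.sum_nonneg fun i _ => sq_nonneg _
  have hι : Nonempty ι := by
    by_contra hne
    rw [not_nonempty_iff] at hne
    simp [hXdef, hYdef] at hΔ
  obtain ⟨j, -, hj⟩ : ∃ j ∈ (Finset.univ : Finset ι),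
      Q j ≤ (X - Y) * (-1 - inner ℝ (w j) (M (w j))) := by
    refine Finset.exists_le_of_sum_le Finset.univ_nonempty ?_
    calc ∑ j, Q j ≤ ∑ j, Λ * ‖M (w j)‖ ^ 2 := Finset.sum_le_sum fun j _ => hbessel _
      _ = Λ * ∑ j, ‖M (w j)‖ ^ 2 := by rw [Finset.mul_sum]
      _ ≤ _ := hkey
      _ = _ := by
        rw [← Finset.mul_sum, Finset.sum_sub_distrib]
        simp [hYdef]
  have hlt : inner ℝ (w j) (M (w j)) < -1 := by
    have h1 : 0 ≤ -1 - inner ℝ (w j) (M (w j)) :=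
      nonneg_of_mul_nonneg_right ((hQ0 j).trans hj) hΔ
    rcases h1.lt_or_eq with h2 | h2
    · linarith
    · rw [← h2, mul_zero] at hj
      have h3 : inner ℝ (w j) (M (w j)) ^ 2 ≤ Q j :=
        Finset.single_le_sum (f := fun i => inner ℝ (w i) (M (w j)) ^ 2)
          (fun i _ => sq_nonneg _) (Finset.mem_univ j)
      nlinarith
  have hjσ : j ∉ σ := by
    intro hmem
    have : 0 ≤ inner ℝ (w j) (M (w j)) := by
      rw [hM.inner_apply e hA he hlb']
      refine Finset.sum_nonneg fun i _ => ?_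
      rcases hl i with h0 | h0
      · have h1 := inner_frameOp w σ (e i) (e i)
        rw [he, h0, zero_smul, inner_zero_left] at h1
        have h2 := (Finset.sum_eq_zero_iff_of_nonneg fun k _ => mul_self_nonneg _).mp h1.symm j hmem
        rw [real_inner_comm (w j) (e i), h2, mul_zero]
      · have h1 : 0 < l i - b' := by linarith
        exact mul_nonneg (inv_pos.mpr h1).le (mul_self_nonneg _)
    linarith
  refine ⟨j, hjσ, (hR.mono hbb.le).insert hb' hjσ (hM (w j)) hlt,
    M - (1 + inner ℝ (w j) (M (w j)))⁻¹ • (innerₛₗ ℝ (M (w j))).smulRight (M (w j)), ?_, ?_⟩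
  · have := hM.rankOne_update hMs (u := w j) (ne_of_lt (by linarith))
    rwa [frameOp, Finset.sum_insert hjσ, add_comm]
  · have hden : 1 + inner ℝ (w j) (M (w j)) < 0 := by linarith
    have hterm : ∀ i, inner ℝ (w i) ((M - (1 + inner ℝ (w j) (M (w j)))⁻¹ •
        (innerₛₗ ℝ (M (w j))).smulRight (M (w j))) (w i)) =
        inner ℝ (w i) (M (w i))
          - (1 + inner ℝ (w j) (M (w j)))⁻¹ * inner ℝ (w i) (M (w j)) ^ 2 := by
      intro i
      simp only [LinearMap.sub_apply, LinearMap.smul_apply, LinearMap.smulRight_apply,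
        innerₛₗ_apply_apply, inner_sub_right, real_inner_smul_right]
      rw [real_inner_comm (w i) (M (w j))]
      ring
    simp_rw [hterm]
    rw [Finset.sum_sub_distrib, ← Finset.mul_sum]
    change Y - (1 + inner ℝ (w j) (M (w j)))⁻¹ * Q j ≤ X
    have h1 : (1 + inner ℝ (w j) (M (w j)))⁻¹ * Q j
        = -(Q j / (-1 - inner ℝ (w j) (M (w j)))) := by
      rw [← neg_add', div_neg, neg_neg, div_eq_inv_mul]
    have h2 : Q j / (-1 - inner ℝ (w j) (M (w j))) ≤ X - Y :=
      (div_le_iff₀ (by linarith)).mpr hj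
    linarith

/-- Iterating the barrier step `k` times from the empty set. -/
theorem exists_strictRiesz [Fintype ι] [FiniteDimensional ℝ E] {w : ι → E}
    {Λ : ℝ} (hΛ : 0 < Λ) (hbessel : ∀ x, ∑ i, inner ℝ (w i) x ^ 2 ≤ Λ * ‖x‖ ^ 2)
    (hunit : ∀ i, ‖w i‖ = 1) {b δ : ℝ} (hb : 0 < b) (hδ : 0 < δ)
    (hstart : (Fintype.card ι : ℝ) + Λ / δ ≤ Fintype.card ι / b) (k : ℕ) (hk : k * δ < b) :
    ∃ σ : Finset ι, σ.card = k ∧ StrictRiesz w σ (b - k * δ) := by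
  classical
  suffices h : ∃ σ : Finset ι, σ.card = k ∧ StrictRiesz w σ (b - k * δ) ∧
      ∃ N : E →ₗ[ℝ] E, IsResolvent (frameOp w σ) (b - k * δ) N ∧
        ∑ i, inner ℝ (w i) (N (w i)) ≤ -(Fintype.card ι : ℝ) - Λ / δ by
    obtain ⟨σ, h1, h2, -⟩ := h
    exact ⟨σ, h1, h2⟩
  induction k with
  | zero =>
    refine ⟨∅, rfl, fun a ha => by simp at ha, -(b⁻¹ • LinearMap.id), fun x => ?_, ?_⟩
    · simp [frameOp, smul_smul, hb.ne']
    · simp only [LinearMap.neg_apply, LinearMap.smul_apply, LinearMap.id_apply, inner_neg_right,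
        real_inner_smul_right, real_inner_self_eq_norm_sq, hunit]
      simp only [one_pow, mul_one, Finset.sum_const, Finset.card_univ, nsmul_eq_mul]
      rw [div_eq_mul_inv _ b] at hstart
      linarith
  | succ k ih =>
    push_cast at hk ⊢
    obtain ⟨σ, hcard, hR, N, hN, hpot⟩ := ih (by nlinarith)
    have hgap : b - k * δ - (b - (k + 1) * δ) = δ := by ring
    obtain ⟨j, hj, hR', N', hN', hle⟩ := exists_insert hΛ hbessel (b' := b - (k + 1) * δ)
      (by linarith) (by linarith) hR hN (by rwa [hgap])
    exact ⟨insert j σ, by rw [Finset.card_insert_of_notMem hj, hcard], hR', N', hN', hle.trans hpot⟩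

/-- Restricted invertibility for unit vectors satisfying a Bessel inequality. -/
theorem exists_riesz_subset [Fintype ι] [FiniteDimensional ℝ E] {w : ι → E}
    {Λ ε : ℝ} (hε0 : 0 < ε) (hε : ε < 1 / 2) (hΛ0 : 0 ≤ Λ)
    (hbessel : ∀ x, ∑ i, inner ℝ (w i) x ^ 2 ≤ Λ * ‖x‖ ^ 2) (hunit : ∀ i, ‖w i‖ = 1) :
    ∃ σ : Finset ι, ε ^ 2 * Fintype.card ι / Λ ≤ σ.card ∧
      ∀ a : ι → ℝ, (1 - 2 * ε) * (1 - ε) * ∑ i ∈ σ, a i ^ 2 ≤ ‖∑ i ∈ σ, a i • w i‖ ^ 2 := by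
  classical
  set n := (Fintype.card ι : ℝ) with hn
  have hcoef : (1 - 2 * ε) * (1 - ε) ≤ 1 := by nlinarith
  rcases isEmpty_or_nonempty ι with hι | ⟨⟨i₀⟩⟩
  · exact ⟨∅, by simp [hn], by simp⟩
  rcases le_or_gt (ε ^ 2 * n / Λ) 1 with hsmall | hlarge
  · refine ⟨{i₀}, by simpa using hsmall, fun a => ?_⟩
    simp only [Finset.sum_singleton, norm_smul, hunit, mul_one, Real.norm_eq_abs, sq_abs]
    nlinarith [sq_nonneg (a i₀)]
  have hΛ : 0 < Λ := by
    rcases hΛ0.lt_or_eq with h | h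
    · exact h
    · rw [← h, div_zero] at hlarge
      linarith
  have hn0 : 0 < n := by
    rw [hn]
    exact_mod_cast Fintype.card_pos_iff.mpr ⟨i₀⟩
  have h1ε : 0 < 1 - ε := by linarith
  set δ : ℝ := (1 - ε) * Λ / (ε * n) with hδ
  have hδ0 : 0 < δ := by positivity
  set k := ⌈ε ^ 2 * n / Λ⌉₊ with hk
  have hk2 : (k : ℝ) ≤ 2 * (ε ^ 2 * n / Λ) := by
    have := Nat.ceil_lt_add_one (a := ε ^ 2 * n / Λ) (by positivity)
    linarith
  have hkδ : k * δ ≤ 2 * ε * (1 - ε) := by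
    calc k * δ ≤ 2 * (ε ^ 2 * n / Λ) * δ := mul_le_mul_of_nonneg_right hk2 hδ0.le
      _ = 2 * ε * (1 - ε) := by rw [hδ]; field_simp
  have hstart : n + Λ / δ ≤ n / (1 - ε) := by
    apply le_of_eq
    rw [hδ]
    field_simp
    ring
  obtain ⟨σ, hcard, hR⟩ := exists_strictRiesz hΛ hbessel hunit h1ε hδ0 hstart k (by nlinarith)
  refine ⟨σ, by rw [hcard]; exact Nat.le_ceil _, fun a => ?_⟩
  by_cases ha : ∃ i ∈ σ, a i ≠ 0
  · exact (hR.mono (by linarith) a ha).le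
  · push Not at ha
    rw [Finset.sum_eq_zero fun i hi => by rw [ha i hi]; ring, mul_zero]
    positivity

end RestrictedInvertibility

/-- the Bourgain–Tzafriri Restricted Invertibility Theorem with constant
`(1 − 2ε)(1 − ε)`. -/
theorem bourgain_tzafriri_restricted_invertibility
    (n : ℕ) (ε : ℝ) (hε0 : 0 < ε) (hε : ε < 1 / 2)
    (v : Fin n → Fin n → ℝ)
    (hortho : ∀ i j : Fin n, v i ⬝ᵥ v j = if i = j then (1 : ℝ) else 0)
    (L : Matrix (Fin n) (Fin n) ℝ)
    (hnorm : ∀ i : Fin n, (L *ᵥ v i) ⬝ᵥ (L *ᵥ v i) = 1) :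
    ∃ σ : Finset (Fin n),
      ε ^ 2 * n / ‖Matrix.toEuclideanCLM (𝕜 := ℝ) L‖ ^ 2 ≤ σ.card ∧
      ∀ a : Fin n → ℝ,
        (1 - 2 * ε) * (1 - ε) * ∑ i ∈ σ, a i ^ 2 ≤
          (∑ i ∈ σ, a i • (L *ᵥ v i)) ⬝ᵥ (∑ i ∈ σ, a i • (L *ᵥ v i)) := by
  set T := Matrix.toEuclideanCLM (𝕜 := ℝ) L with hT
  have hdot : ∀ x : Fin n → ℝ, ‖WithLp.toLp 2 x‖ ^ 2 = x ⬝ᵥ x := fun x => by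
    rw [EuclideanSpace.real_norm_sq_eq]
    exact Finset.sum_congr rfl fun i _ => pow_two _
  have hTv : ∀ i, T (WithLp.toLp 2 (v i)) = WithLp.toLp 2 (L *ᵥ v i) := fun i => by
    rw [hT, Matrix.toEuclideanCLM_toLp]
  have hv : Orthonormal ℝ fun i => (WithLp.toLp 2 (v i) : EuclideanSpace ℝ (Fin n)) := by
    rw [orthonormal_iff_ite]
    intro i j
    rw [← hortho i j, EuclideanSpace.inner_toLp_toLp, star_trivial, dotProduct_comm]
  obtain ⟨σ, hcard, hσ⟩ := RestrictedInvertibility.exists_riesz_subset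
    (w := fun i => T (WithLp.toLp 2 (v i))) (Λ := ‖T‖ ^ 2) hε0 hε (sq_nonneg _)
    (fun x => by
      calc ∑ i, inner ℝ (T (WithLp.toLp 2 (v i))) x ^ 2
          = ∑ i, ‖inner ℝ (WithLp.toLp 2 (v i)) (T.adjoint x)‖ ^ 2 :=
            Finset.sum_congr rfl fun i _ => by
              rw [ContinuousLinearMap.adjoint_inner_right, Real.norm_eq_abs, sq_abs]
        _ ≤ ‖T.adjoint x‖ ^ 2 := hv.sum_inner_products_le _
        _ ≤ (‖T‖ * ‖x‖) ^ 2 := by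
            gcongr
            simpa using T.adjoint.le_opNorm x
        _ = ‖T‖ ^ 2 * ‖x‖ ^ 2 := mul_pow _ _ _)
    (fun i => by
      have h : ‖T (WithLp.toLp 2 (v i))‖ ^ 2 = 1 := by rw [hTv, hdot, hnorm]
      exact (pow_eq_one_iff_of_nonneg (norm_nonneg _) two_ne_zero).mp h)
  refine ⟨σ, by simpa using hcard, fun a => ?_⟩
  rw [← hdot]
  have h := hσ a
  simp_rw [hTv, ← WithLp.toLp_smul, ← WithLp.toLp_sum] at h
  exact h
end
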